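/- Assume condition (H). Then the recursive optimal transport metric satisfies the convex quadrangle inequality: d_{i,l} + d_{j,k} ≤ d_{i,k} + d_{j,l} for all −1 ≤ i ≤ j ≤ k ≤ l. -/

import Mathlib

/-- `p` is a probability distribution on `ℕ` supported on `{0,…,n}`. -/
def IsProbOn (p : ℕ → ℝ) (n : ℕ) : Prop :=
  (∀ i, 0 ≤ p i) ∧ (∀ i, n < i → p i = 0) ∧ ∑ i ∈ Finset.range (n + 1), p i = 1

/-- `z` is a transport plan from `μ` (supported on `{0,…,m}`) to `ν` (supported on `{0,…,n}`):
a nonnegative matrix on the rectangle `{0,…,m} × {0,…,n}` with row sums `μ` and column sums `ν`. -/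
def IsPlan (μ ν : ℕ → ℝ) (m n : ℕ) (z : ℕ → ℕ → ℝ) : Prop :=
  (∀ i j, 0 ≤ z i j) ∧
  (∀ i j, m < i ∨ n < j → z i j = 0) ∧
  (∀ i, i ≤ m → ∑ j ∈ Finset.range (n + 1), z i j = μ i) ∧
  (∀ j, j ≤ n → ∑ i ∈ Finset.range (m + 1), z i j = ν j)

/-- Transport cost of the plan `z` with ground cost `(i,j) ↦ D i j` (where `D i j`
encodes `d_{i-1,j-1}` of the paper, indices shifted by one so that `0` plays the role of `-1`). -/
noncomputable def cost (D : ℕ → ℕ → ℝ) (m n : ℕ) (z : ℕ → ℕ → ℝ) : ℝ :=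
  ∑ i ∈ Finset.range (m + 1), ∑ j ∈ Finset.range (n + 1), z i j * D i j

/-- `D` is the recursive optimal transport family associated with the weights `π`:
indices are shifted by one, so `D (m+1) (n+1) = d_{m,n}`, `D 0 (j+1) = d_{-1,j} = 1`,
`D 0 0 = d_{-1,-1} = 0`, and `d_{m,n}` is the minimum transport cost from `π m` to `π n`
with ground cost `(i,j) ↦ d_{i-1,j-1} = D i j`. -/
def IsRecursiveOT (π : ℕ → ℕ → ℝ) (D : ℕ → ℕ → ℝ) : Prop :=
  D 0 0 = 0 ∧ (∀ j, D 0 (j + 1) = 1) ∧ (∀ i, D (i + 1) 0 = 1) ∧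
  ∀ m n, IsLeast {c : ℝ | ∃ z, IsPlan (π m) (π n) m n z ∧ c = cost D m n z}
    (D (m + 1) (n + 1))

/-- Condition (H): `π_n^n > 0` and `π_i^n ≤ π_i^{n-1}` for `i < n`. -/
def CondH (π : ℕ → ℕ → ℝ) : Prop :=
  ∀ n, 0 < π (n + 1) (n + 1) ∧ ∀ i, i ≤ n → π (n + 1) i ≤ π n i

open Finset

def SqPlan (μ ν : ℕ → ℝ) (K : ℕ) (z : ℕ → ℕ → ℝ) : Prop :=
  (∀ i j, 0 ≤ z i j) ∧ (∀ i, i < K → ∑ j ∈ range K, z i j = μ i) ∧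
  (∀ j, j < K → ∑ i ∈ range K, z i j = ν j)

def SqCost (D : ℕ → ℕ → ℝ) (K : ℕ) (z : ℕ → ℕ → ℝ) : ℝ :=
  ∑ i ∈ range K, ∑ j ∈ range K, z i j * D i j

lemma sum_cut {n K : ℕ} (h : n < K) (g : ℕ → ℝ) (hg : ∀ i, n < i → i < K → g i = 0) :
    ∑ i ∈ range (n + 1), g i = ∑ i ∈ range K, g i := by
  apply sum_subset
  · intro x hx; simp at *; omega
  · intro x hx hx'
    simp at hx hx'
    exact hg x (by omega) hx

lemma cost_sq {D z : ℕ → ℕ → ℝ} {m n K : ℕ} (hm : m < K) (hn : n < K)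
    (hz : ∀ i j, m < i ∨ n < j → z i j = 0) : cost D m n z = SqCost D K z := by
  unfold cost SqCost
  rw [sum_cut hm]
  · refine sum_congr rfl fun i _ => ?_
    rw [sum_cut hn]
    intro j hj _
    simp [hz i j (Or.inr hj)]
  · intro i hi _
    exact sum_eq_zero fun j _ => by simp [hz i j (Or.inl hi)]

lemma ot_attain {π D : ℕ → ℕ → ℝ} (hπ : ∀ n, IsProbOn (π n) n) (hD : IsRecursiveOT π D)
    {m n K : ℕ} (hm : m < K) (hn : n < K) :
    ∃ z, SqPlan (π m) (π n) K z ∧ D (m + 1) (n + 1) = SqCost D K z := by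
  obtain ⟨z, ⟨h0, hs, hr, hc⟩, he⟩ := (hD.2.2.2 m n).1
  refine ⟨z, ⟨h0, ?_, ?_⟩, by rw [he, cost_sq hm hn hs]⟩
  · intro i hi
    rcases Nat.lt_or_ge m i with h | h
    · rw [(hπ m).2.1 i h]
      exact sum_eq_zero fun j _ => hs i j (Or.inl h)
    · rw [← hr i h, sum_cut hn]
      intro j hj _
      exact hs i j (Or.inr hj)
  · intro j hj
    rcases Nat.lt_or_ge n j with h | h
    · rw [(hπ n).2.1 j h]
      exact sum_eq_zero fun i _ => hs i j (Or.inr h)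
    · rw [← hc j h, sum_cut hm]
      intro i hi _
      exact hs i j (Or.inl hi)

lemma sq_row_zero {μ ν : ℕ → ℝ} {K : ℕ} {z : ℕ → ℕ → ℝ} (h : SqPlan μ ν K z) {i j : ℕ}
    (hi : i < K) (hj : j < K) (h0 : μ i = 0) : z i j = 0 := by
  have := h.2.1 i hi
  rw [h0, sum_eq_zero_iff_of_nonneg (fun _ _ => h.1 _ _)] at this
  exact this j (by simpa using hj)

lemma sq_col_zero {μ ν : ℕ → ℝ} {K : ℕ} {z : ℕ → ℕ → ℝ} (h : SqPlan μ ν K z) {i j : ℕ}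
    (hi : i < K) (hj : j < K) (h0 : ν j = 0) : z i j = 0 := by
  have := h.2.2 j hj
  rw [h0, sum_eq_zero_iff_of_nonneg (fun _ _ => h.1 _ _)] at this
  exact this i (by simpa using hi)

lemma ot_le {π D : ℕ → ℕ → ℝ} (hπ : ∀ n, IsProbOn (π n) n) (hD : IsRecursiveOT π D)
    {m n K : ℕ} (hm : m < K) (hn : n < K) {z : ℕ → ℕ → ℝ} (h : SqPlan (π m) (π n) K z) :
    D (m + 1) (n + 1) ≤ SqCost D K z := by
  set z' : ℕ → ℕ → ℝ := fun i j => if i ≤ m ∧ j ≤ n then z i j else 0 with hz'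
  have hs : ∀ i j, m < i ∨ n < j → z' i j = 0 := by
    intro i j hij
    simp only [hz']
    rw [if_neg (by omega)]
  have heq : ∀ i j, i < K → j < K → z' i j = z i j := by
    intro i j hi hj
    simp only [hz']
    split_ifs with hc
    · rfl
    · rcases Nat.lt_or_ge m i with h1 | h1
      · exact (sq_row_zero h hi hj ((hπ m).2.1 i h1)).symm
      · exact (sq_col_zero h hi hj ((hπ n).2.1 j (by omega))).symm
  have hc : SqCost D K z = SqCost D K z' := by
    unfold SqCost
    refine sum_congr rfl fun i hi => sum_congr rfl fun j hj => ?_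
    rw [heq i j (by simpa using hi) (by simpa using hj)]
  rw [hc, ← cost_sq hm hn hs]
  apply (hD.2.2.2 m n).2
  refine ⟨z', ⟨?_, hs, ?_, ?_⟩, rfl⟩
  · intro i j
    simp only [hz']
    split_ifs
    · exact h.1 _ _
    · exact le_rfl
  · intro i hi
    rw [sum_cut hn _ (fun j hj _ => hs i j (Or.inr hj)), ← h.2.1 i (by omega)]
    exact sum_congr rfl fun j hj => heq i j (by omega) (by simpa using hj)
  · intro j hj
    rw [sum_cut hm _ (fun i hi _ => hs i j (Or.inl hi)), ← h.2.2 j (by omega)]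
    exact sum_congr rfl fun i hi => heq i j (by simpa using hi) (by omega)

lemma prob_sum {p : ℕ → ℝ} {n K : ℕ} (h : IsProbOn p n) (hn : n < K) :
    ∑ i ∈ range K, p i = 1 := by
  rw [← h.2.2, sum_cut hn]
  intro i hi _
  exact h.2.1 i hi

section basic
variable {π D : ℕ → ℕ → ℝ}

lemma D_nonneg (hπ : ∀ n, IsProbOn (π n) n) (hD : IsRecursiveOT π D) :
    ∀ N i j, i ≤ N → j ≤ N → 0 ≤ D i j := by
  intro N
  induction N with
  | zero =>
    intro i j hi hj
    obtain rfl : i = 0 := by omega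
    obtain rfl : j = 0 := by omega
    rw [hD.1]
  | succ N ih =>
    intro i j hi hj
    rcases i with _ | i
    · rcases j with _ | j
      · rw [hD.1]
      · rw [hD.2.1]; norm_num
    · rcases j with _ | j
      · rw [hD.2.2.1]; norm_num
      · obtain ⟨z, hz, he⟩ := ot_attain hπ hD (m := i) (n := j) (K := N + 1) (by omega) (by omega)
        rw [he]
        refine sum_nonneg fun a ha => sum_nonneg fun b hb => mul_nonneg (hz.1 _ _) ?_
        simp at ha hb
        exact ih a b (by omega) (by omega)

lemma D_le_one (hπ : ∀ n, IsProbOn (π n) n) (hD : IsRecursiveOT π D) :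
    ∀ N i j, i ≤ N → j ≤ N → D i j ≤ 1 := by
  intro N
  induction N with
  | zero =>
    intro i j hi hj
    obtain rfl : i = 0 := by omega
    obtain rfl : j = 0 := by omega
    rw [hD.1]; norm_num
  | succ N ih =>
    intro i j hi hj
    rcases i with _ | i
    · rcases j with _ | j
      · rw [hD.1]; norm_num
      · rw [hD.2.1]
    · rcases j with _ | j
      · rw [hD.2.2.1]
      · obtain ⟨z, hz, he⟩ := ot_attain hπ hD (m := i) (n := j) (K := N + 1) (by omega) (by omega)
        rw [he, ← prob_sum (hπ i) (show i < N + 1 by omega)]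
        unfold SqCost
        refine sum_le_sum fun a ha => ?_
        simp at ha
        rw [← hz.2.1 a (by omega)]
        refine sum_le_sum fun b hb => ?_
        simp at hb
        have := ih a b (by omega) (by omega)
        have := hz.1 a b
        nlinarith

lemma D_diag (hπ : ∀ n, IsProbOn (π n) n) (hD : IsRecursiveOT π D) :
    ∀ n, D n n = 0 := by
  intro n
  induction n using Nat.strong_induction_on with
  | _ n ih =>
    rcases n with _ | n
    · exact hD.1
    · refine le_antisymm ?_ (D_nonneg hπ hD _ _ _ le_rfl le_rfl)
      have h : SqPlan (π n) (π n) (n + 1) (fun i j => if i = j then π n i else 0) := by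
        refine ⟨?_, ?_, ?_⟩
        · intro i j
          dsimp only
          split_ifs
          · exact (hπ n).1 i
          · exact le_rfl
        · intro i hi
          rw [Finset.sum_ite_eq, if_pos (by simpa using hi)]
        · intro j hj
          rw [Finset.sum_ite_eq', if_pos (by simpa using hj)]
      refine (ot_le hπ hD (by omega) (by omega) h).trans (le_of_eq ?_)
      refine sum_eq_zero fun i hi => sum_eq_zero fun j hj => ?_
      by_cases hij : i = j
      · subst hij
        simp at hi
        rw [ih i (by omega)]; simp
      · simp [hij]

lemma D_tri (hπ : ∀ n, IsProbOn (π n) n) (hD : IsRecursiveOT π D) :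
    ∀ N i j k, i ≤ N → j ≤ N → k ≤ N → D i k ≤ D i j + D j k := by
  intro N
  have hnn : ∀ i j, 0 ≤ D i j := fun i j => D_nonneg hπ hD (max i j) i j (by simp) (by simp)
  have hle : ∀ i j, D i j ≤ 1 := fun i j => D_le_one hπ hD (max i j) i j (by simp) (by simp)
  induction N with
  | zero =>
    intro i j k hi hj hk
    obtain rfl : i = 0 := by omega
    obtain rfl : j = 0 := by omega
    linarith [hnn 0 0]
  | succ N ih =>
    intro i j k hi hj hk
    rcases j with _ | j
    · rcases i with _ | i
      · linarith [hnn 0 0]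
      · rw [hD.2.2.1]
        linarith [hle (i+1) k, hnn 0 k]
    rcases i with _ | i
    · rw [hD.2.1]
      linarith [hle 0 k, hnn (j+1) k]
    rcases k with _ | k
    · rw [hD.2.2.1, hD.2.2.1]
      linarith [hnn (i+1) (j+1)]
    set K := N + 1 with hK
    obtain ⟨x, hx, hxe⟩ := ot_attain hπ hD (m := i) (n := j) (K := K) (by omega) (by omega)
    obtain ⟨y, hy, hye⟩ := ot_attain hπ hD (m := j) (n := k) (K := K) (by omega) (by omega)
    set ν := π j with hν
    have hνn : ∀ s, 0 ≤ ν s := (hπ j).1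
    have hrow : ∀ a, a < K → ∀ s ∈ range K, ∑ c ∈ range K, x a s * y s c / ν s = x a s := by
      intro a ha s hs
      simp at hs
      rw [← sum_div, ← mul_sum, hy.2.1 s hs]
      by_cases h0 : ν s = 0
      · rw [sq_col_zero hx ha hs h0]; simp
      · field_simp
    have hcol : ∀ c, c < K → ∀ s ∈ range K, ∑ a ∈ range K, x a s * y s c / ν s = y s c := by
      intro c hc s hs
      simp at hs
      rw [← sum_div, ← sum_mul, hx.2.2 s hs]
      by_cases h0 : ν s = 0
      · rw [sq_row_zero hy hs hc h0]; simp
      · field_simp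
    have h : SqPlan (π i) (π k) K (fun a c => ∑ s ∈ range K, x a s * y s c / ν s) := by
      refine ⟨?_, ?_, ?_⟩
      · intro a c
        exact sum_nonneg fun s _ => div_nonneg (mul_nonneg (hx.1 _ _) (hy.1 _ _)) (hνn s)
      · intro a ha
        dsimp only
        rw [sum_comm, sum_congr rfl (hrow a ha), hx.2.1 a ha]
      · intro c hc
        dsimp only
        rw [sum_comm, sum_congr rfl (hcol c hc), hy.2.2 c hc]
    refine (ot_le hπ hD (by omega) (by omega) h).trans ?_
    rw [hxe, hye]
    have e1 : SqCost D K x = ∑ a ∈ range K, ∑ c ∈ range K, ∑ s ∈ range K,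
        x a s * y s c / ν s * D a s := by
      unfold SqCost
      refine sum_congr rfl fun a ha => ?_
      rw [sum_comm]
      refine sum_congr rfl fun s hs => ?_
      rw [← sum_mul, hrow a (by simpa using ha) s hs]
    have e2 : SqCost D K y = ∑ a ∈ range K, ∑ c ∈ range K, ∑ s ∈ range K,
        x a s * y s c / ν s * D s c := by
      unfold SqCost
      rw [sum_comm]
      conv_rhs => rw [sum_comm]
      refine sum_congr rfl fun c hc => ?_
      rw [sum_comm]
      refine sum_congr rfl fun s hs => ?_
      rw [← sum_mul, hcol c (by simpa using hc) s hs]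
    rw [e1, e2]
    unfold SqCost
    rw [← sum_add_distrib]
    refine sum_le_sum fun a ha => ?_
    rw [← sum_add_distrib]
    refine sum_le_sum fun c hc => ?_
    rw [← sum_add_distrib, sum_mul]
    refine sum_le_sum fun s hs => ?_
    simp at ha hc hs
    rw [← mul_add]
    exact mul_le_mul_of_nonneg_left (ih a s c (by omega) (by omega) (by omega))
      (div_nonneg (mul_nonneg (hx.1 _ _) (hy.1 _ _)) (hνn s))

end basic

/-- mixed second difference -/
def mix (D : ℕ → ℕ → ℝ) (a b : ℕ) : ℝ := D a b + D (a + 1) (b + 1) - D a (b + 1) - D (a + 1) b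

lemma rect (D : ℕ → ℕ → ℝ) {i j k l : ℕ} (hij : i ≤ j) (hkl : k ≤ l) :
    ∑ a ∈ Ico i j, ∑ b ∈ Ico k l, mix D a b = D i k + D j l - D i l - D j k := by
  have h1 : ∀ a, ∑ b ∈ Ico k l, mix D a b = D a k + D (a + 1) l - D a l - D (a + 1) k := by
    intro a
    induction l, hkl using Nat.le_induction with
    | base => simp
    | succ l hl ih => rw [sum_Ico_succ_top hl, ih, mix]; ring
  simp only [h1]
  induction j, hij using Nat.le_induction with
  | base => simp
  | succ j hj ih => rw [sum_Ico_succ_top hj, ih]; ring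

/-- ground cost decomposition -/
lemma decomp {D : ℕ → ℕ → ℝ} {M K i j : ℕ} (h01 : ∀ j, D 0 (j + 1) = 1) (hM : 1 ≤ M)
    (hi : i ≤ M) (hMj : M ≤ j) (hj : j < K) :
    D i j = D i M + ∑ a ∈ range M, ∑ b ∈ Ico M (K - 1),
      mix D a b * (if a < i ∧ b < j then 1 else 0) := by
  have h := rect D (Nat.zero_le i) hMj
  obtain ⟨M', rfl⟩ : ∃ M', M = M' + 1 := ⟨M - 1, by omega⟩
  obtain ⟨j', rfl⟩ : ∃ j', j = j' + 1 := ⟨j - 1, by omega⟩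
  rw [h01, h01] at h
  have h2 : ∑ a ∈ range (M' + 1), ∑ b ∈ Ico (M' + 1) (K - 1),
      mix D a b * (if a < i ∧ b < j' + 1 then 1 else 0)
      = ∑ a ∈ Ico 0 i, ∑ b ∈ Ico (M' + 1) (j' + 1), mix D a b := by
    symm
    have e : ∀ a ∈ Ico 0 i, ∑ b ∈ Ico (M' + 1) (j' + 1), mix D a b
        = ∑ b ∈ Ico (M' + 1) (K - 1), mix D a b * (if a < i ∧ b < j' + 1 then 1 else 0) := by
      intro a ha
      simp at ha
      rw [← sum_subset (s₁ := Ico (M' + 1) (j' + 1)) (s₂ := Ico (M' + 1) (K - 1))]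
      · refine sum_congr rfl fun b hb => ?_
        simp at hb
        rw [if_pos (by omega), mul_one]
      · intro b hb; simp at *; omega
      · intro b hb hb'
        simp at hb hb'
        rw [if_neg (by omega), mul_zero]
    rw [sum_congr rfl e]
    apply sum_subset
    · intro b hb; simp at *; omega
    · intro a ha ha'
      simp at ha ha'
      refine sum_eq_zero fun b _ => ?_
      rw [if_neg (by omega), mul_zero]
  rw [h2, h]; ring

/-- value of the transport problem -/
noncomputable def G (D : ℕ → ℕ → ℝ) (M K : ℕ) (f : ℕ → ℝ) : ℝ :=
  ∑ i ∈ range M, D i M * f i + ∑ a ∈ range M, ∑ b ∈ Ico M (K - 1),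
    mix D a b * max 0 (∑ t ∈ Ico (a + 1) (b + 1), f t)

lemma sum_indicator (f : ℕ → ℝ) {a b K : ℕ} (hb : b < K) :
    ∑ t ∈ range K, f t * (if a < t ∧ t ≤ b then 1 else 0) = ∑ t ∈ Ico (a + 1) (b + 1), f t := by
  symm
  rw [← sum_subset (s₁ := Ico (a + 1) (b + 1)) (s₂ := range K)]
  · refine sum_congr rfl fun t ht => ?_
    simp at ht
    rw [if_pos (by omega), mul_one]
  · intro t ht; simp at *; omega
  · intro t ht ht'
    simp at ht ht'
    rw [if_neg (by omega), mul_zero]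

lemma lower {D z : ℕ → ℕ → ℝ} {μ ν : ℕ → ℝ} {M K : ℕ} (h01 : ∀ j, D 0 (j + 1) = 1)
    (hdiag : ∀ n, D n n = 0) (htri : ∀ i j k, D i k ≤ D i j + D j k)
    (hM : 1 ≤ M) (hMK : M < K)
    (hw : ∀ a b, a < M → M ≤ b → b < K - 1 → 0 ≤ mix D a b)
    (hz : SqPlan μ ν K z) (hpos : ∀ t, t < M → ν t ≤ μ t)
    (hneg : ∀ t, M < t → t < K → μ t ≤ ν t) :
    G D M K (fun t => μ t - ν t) ≤ SqCost D K z := by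
  set f : ℕ → ℝ := fun t => μ t - ν t with hf
  set s : ℕ → ℕ → ℝ := fun a b => if 0 < ∑ t ∈ Ico (a + 1) (b + 1), f t then 1 else 0 with hs
  have hs0 : ∀ a b, 0 ≤ s a b := by intro a b; simp only [hs]; split_ifs <;> norm_num
  have hs1 : ∀ a b, s a b ≤ 1 := by intro a b; simp only [hs]; split_ifs <;> norm_num
  set θ : ℕ → ℝ := fun t => (if t < M then D t M else 0) +
    ∑ a ∈ range M, ∑ b ∈ Ico M (K - 1), mix D a b * (s a b * (if a < t ∧ t ≤ b then 1 else 0))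
    with hθ
  have hθD : ∀ i j, i ≤ M → M ≤ j → j < K → θ i - θ j ≤ D i j := by
    intro i j hi hMj hj
    rw [decomp h01 hM hi hMj hj]
    simp only [hθ]
    have e1 : (if i < M then D i M else 0) = D i M := by
      split_ifs with h
      · rfl
      · obtain rfl : i = M := by omega
        rw [hdiag]
    rw [e1, if_neg (show ¬ j < M by omega)]
    have : ∑ a ∈ range M, ∑ b ∈ Ico M (K - 1),
        mix D a b * (s a b * (if a < i ∧ i ≤ b then 1 else 0)) ≤
        (∑ a ∈ range M, ∑ b ∈ Ico M (K - 1), mix D a b * (if a < i ∧ b < j then 1 else 0)) +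
        ∑ a ∈ range M, ∑ b ∈ Ico M (K - 1),
          mix D a b * (s a b * (if a < j ∧ j ≤ b then 1 else 0)) := by
      rw [← sum_add_distrib]
      refine sum_le_sum fun a ha => ?_
      rw [← sum_add_distrib]
      refine sum_le_sum fun b hb => ?_
      simp at ha hb
      rw [← mul_add]
      refine mul_le_mul_of_nonneg_left ?_ (hw a b ha hb.1 hb.2)
      have := hs0 a b
      have := hs1 a b
      by_cases h1 : a < i
      · by_cases h2 : b < j
        · rw [if_pos (by omega), if_pos (by omega), if_neg (by omega)]; linarith
        · rw [if_pos (by omega), if_neg (by omega), if_pos (by omega)]; linarith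
      · rw [if_neg (by omega), if_neg (by omega)]
        split_ifs <;> linarith
    linarith
  have hne : (Ico M K).Nonempty := ⟨M, by simp [hMK]⟩
  set ψ : ℕ → ℝ := fun k => (Ico M K).inf' hne (fun r => θ r + D k r) with hψ
  have hψL : ∀ i j, ψ i - ψ j ≤ D i j := by
    intro i j
    have : ψ i - D i j ≤ ψ j := by
      apply le_inf'
      intro r hr
      have h1 : ψ i ≤ θ r + D i r := inf'_le _ hr
      linarith [htri i j r]
    linarith
  have hψu : ∀ i, i ≤ M → θ i ≤ ψ i := by
    intro i hi
    apply le_inf'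
    intro r hr
    simp at hr
    linarith [hθD i r hi hr.1 hr.2]
  have hψv : ∀ j, M ≤ j → j < K → ψ j ≤ θ j := by
    intro j h1 h2
    have : ψ j ≤ θ j + D j j := inf'_le _ (by simp [h1, h2])
    linarith [hdiag j]
  have hA : ∑ t ∈ range K, f t * ψ t ≤ SqCost D K z := by
    have e1 : ∑ t ∈ range K, μ t * ψ t = ∑ i ∈ range K, ∑ j ∈ range K, z i j * ψ i := by
      refine sum_congr rfl fun i hi => ?_
      rw [← sum_mul, hz.2.1 i (by simpa using hi)]
    have e2 : ∑ t ∈ range K, ν t * ψ t = ∑ i ∈ range K, ∑ j ∈ range K, z i j * ψ j := by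
      rw [sum_comm]
      refine sum_congr rfl fun i hi => ?_
      rw [← sum_mul, hz.2.2 i (by simpa using hi)]
    have e3 : ∑ t ∈ range K, f t * ψ t = ∑ i ∈ range K, ∑ j ∈ range K, z i j * (ψ i - ψ j) := by
      simp only [hf, sub_mul, mul_sub, sum_sub_distrib]
      rw [e1, e2]
    rw [e3]
    exact sum_le_sum fun i _ => sum_le_sum fun j _ =>
      mul_le_mul_of_nonneg_left (hψL i j) (hz.1 i j)
  refine le_trans ?_ hA
  have hB : ∑ t ∈ range K, f t * θ t ≤ ∑ t ∈ range K, f t * ψ t := by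
    refine sum_le_sum fun t ht => ?_
    simp at ht
    rcases lt_trichotomy t M with h | h | h
    · exact mul_le_mul_of_nonneg_left (hψu t h.le) (by simp only [hf]; linarith [hpos t h])
    · rw [le_antisymm (hψu t h.le) (hψv t h.ge ht)]
    · exact mul_le_mul_of_nonpos_left (hψv t h.le ht) (by simp only [hf]; linarith [hneg t h ht])
  refine le_trans (le_of_eq ?_) hB
  simp only [hθ, mul_add, sum_add_distrib, G]
  congr 1
  · rw [← sum_subset (s₁ := range M) (s₂ := range K)]
    · refine sum_congr rfl fun t ht => ?_
      simp at ht
      rw [if_pos ht, mul_comm]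
    · intro t ht; simp at *; omega
    · intro t ht ht'
      simp at ht ht'
      rw [if_neg (by omega), mul_zero]
  · simp only [mul_sum]
    symm
    rw [sum_comm]
    refine sum_congr rfl fun a _ => ?_
    rw [sum_comm]
    refine sum_congr rfl fun b hb => ?_
    simp at hb
    have e : ∑ t ∈ range K, f t * (mix D a b * (s a b * (if a < t ∧ t ≤ b then 1 else 0)))
        = mix D a b * (s a b * ∑ t ∈ Ico (a + 1) (b + 1), f t) := by
      rw [← sum_indicator f (show b < K by omega), mul_sum, mul_sum]
      exact sum_congr rfl fun t _ => by ring
    rw [e]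
    congr 1
    simp only [hs]
    split_ifs with h
    · rw [max_eq_right h.le, one_mul]
    · rw [max_eq_left (not_lt.mp h), zero_mul]

lemma anti_plan {α β : ℕ → ℝ} {K : ℕ} (hα : ∀ i, 0 ≤ α i) (hβ : ∀ i, 0 ≤ β i)
    (hT : ∑ i ∈ range K, α i = ∑ i ∈ range K, β i) :
    ∃ z, SqPlan α β K z ∧ ∀ a b, a ≤ K → b ≤ K →
      ∑ i ∈ Ico a K, ∑ j ∈ Ico b K, z i j =
        max 0 (∑ j ∈ Ico b K, β j - ∑ i ∈ range a, α i) := by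
  set A : ℕ → ℝ := fun a => ∑ i ∈ range a, α i with hA
  set B : ℕ → ℝ := fun b => ∑ j ∈ Ico b K, β j with hB
  have hA1 : ∀ i, A (i + 1) = A i + α i := fun i => sum_range_succ _ _
  have hB1 : ∀ j, j < K → B j = β j + B (j + 1) := fun j hj => sum_eq_sum_Ico_succ_bot hj _
  have hB2 : ∀ j, B (j + 1) ≤ B j := by
    intro j
    rcases Nat.lt_or_ge j K with h | h
    · rw [hB1 j h]; linarith [hβ j]
    · simp only [hB]
      rw [Ico_eq_empty (by omega), Ico_eq_empty (by omega)]
  have hA0 : ∀ a, 0 ≤ A a := fun a => sum_nonneg fun i _ => hα i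
  have hB0 : ∀ b, 0 ≤ B b := fun a => sum_nonneg fun i _ => hβ i
  have hBK : B K = 0 := by simp [hB]
  have hAz : A 0 = 0 := by simp [hA]
  have hAK : A K = B 0 := by simp only [hA, hB]; rw [hT, range_eq_Ico]
  have hAle : ∀ a, a ≤ K → A a ≤ A K := fun a ha =>
    sum_le_sum_of_subset_of_nonneg (by intro x; simp; omega) fun i _ _ => hα i
  have hBle : ∀ b, B b ≤ B 0 := fun b =>
    sum_le_sum_of_subset_of_nonneg (by intro x; simp) fun i _ _ => hβ i
  set H : ℕ → ℕ → ℝ := fun a b => min (A a) (B b) with hH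
  refine ⟨fun i j => - mix H i j, ⟨?_, ?_, ?_⟩, ?_⟩
  · intro i j
    simp only [mix, hH]
    have h1 := hA1 i
    have h2 := hα i
    have h3 := hB2 j
    have h4 : A i ≤ A (i + 1) := by linarith
    rcases le_total (A i) (B j) with c1 | c1 <;> rcases le_total (A (i+1)) (B j) with c2 | c2 <;>
    rcases le_total (A i) (B (j+1)) with c3 | c3 <;>
    rcases le_total (A (i+1)) (B (j+1)) with c4 | c4 <;>
    simp only [c1, c2, c3, c4, min_eq_left, min_eq_right] <;> linarith
  · intro i hi
    have := rect H (Nat.le_succ i) (Nat.zero_le K)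
    simp only [Nat.succ_eq_add_one, Nat.Ico_succ_singleton, sum_singleton] at this
    rw [sum_neg_distrib, range_eq_Ico, this]
    simp only [hH, hBK]
    rw [min_eq_right (hA0 _), min_eq_right (hA0 _), min_eq_left (hAK ▸ hAle _ (by omega)),
      min_eq_left (hAK ▸ hAle _ (by omega)), hA1]
    ring
  · intro j hj
    have := rect H (Nat.zero_le K) (Nat.le_succ j)
    simp only [Nat.succ_eq_add_one, Nat.Ico_succ_singleton, sum_singleton] at this
    rw [sum_neg_distrib, range_eq_Ico, this]
    simp only [hH, hAz, hAK]
    rw [min_eq_left (hB0 _), min_eq_left (hB0 _), min_eq_right (hBle _),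
      min_eq_right (hBle _), hB1 j hj]
    ring
  · intro a b ha hb
    simp only [sum_neg_distrib]
    rw [rect H ha hb]
    simp only [hH, hBK]
    rw [min_eq_right (hA0 _), min_eq_right (hA0 _), hAK, min_eq_right (hBle _)]
    change _ = max 0 (B b - A a)
    rcases le_total (A a) (B b) with c | c
    · rw [min_eq_left c, max_eq_right (by linarith)]; ring
    · rw [min_eq_right c, max_eq_left (by linarith)]; ring

lemma upper {D : ℕ → ℕ → ℝ} {μ ν : ℕ → ℝ} {M K : ℕ} (h01 : ∀ j, D 0 (j + 1) = 1)
    (hdiag : ∀ n, D n n = 0) (hM : 1 ≤ M) (hMK : M < K)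
    (hμ : ∀ i, 0 ≤ μ i) (hν : ∀ i, 0 ≤ ν i)
    (hT : ∑ i ∈ range K, μ i = ∑ i ∈ range K, ν i)
    (hpos : ∀ t, t < M → ν t ≤ μ t)
    (hneg : ∀ t, M < t → t < K → μ t ≤ ν t) :
    ∃ z, SqPlan μ ν K z ∧ SqCost D K z = G D M K (fun t => μ t - ν t) := by
  set f : ℕ → ℝ := fun t => μ t - ν t with hf
  set α : ℕ → ℝ := fun t => μ t - min (μ t) (ν t) with hα
  set β : ℕ → ℝ := fun t => ν t - min (μ t) (ν t) with hβ
  have hα0 : ∀ t, 0 ≤ α t := fun t => sub_nonneg.2 (min_le_left _ _)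
  have hβ0 : ∀ t, 0 ≤ β t := fun t => sub_nonneg.2 (min_le_right _ _)
  have hαM : ∀ t, t < M → α t = f t := by
    intro t ht; simp only [hα, hf]; rw [min_eq_right (hpos t ht)]
  have hαM' : ∀ t, M < t → t < K → α t = 0 := by
    intro t ht htK; simp only [hα]; rw [min_eq_left (hneg t ht htK)]; ring
  have hβM : ∀ t, t < M → β t = 0 := by
    intro t ht; simp only [hβ]; rw [min_eq_right (hpos t ht)]; ring
  have hβM' : ∀ t, M < t → t < K → β t = - f t := by
    intro t ht htK; simp only [hβ, hf]; rw [min_eq_left (hneg t ht htK)]; ring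
  obtain ⟨y, hy, hyr⟩ := anti_plan (K := K) hα0 hβ0 (by
    simp only [hα, hβ, sum_sub_distrib]; rw [hT])
  have hf0 : ∑ t ∈ range K, f t = 0 := by
    simp only [hf, sum_sub_distrib]; rw [hT]; ring
  refine ⟨fun i j => y i j + if i = j then min (μ i) (ν i) else 0, ⟨?_, ?_, ?_⟩, ?_⟩
  · intro i j
    refine add_nonneg (hy.1 i j) ?_
    split_ifs
    · exact le_min (hμ i) (hν i)
    · exact le_rfl
  · intro i hi
    dsimp only
    rw [sum_add_distrib, hy.2.1 i hi, Finset.sum_ite_eq, if_pos (by simpa using hi)]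
    simp only [hα]; ring
  · intro j hj
    dsimp only
    rw [sum_add_distrib, hy.2.2 j hj, Finset.sum_ite_eq', if_pos (by simpa using hj)]
    simp only [hβ]; ring
  · have e1 : SqCost D K (fun i j => y i j + if i = j then min (μ i) (ν i) else 0)
        = ∑ i ∈ range K, ∑ j ∈ range K, (y i j * D i M + ∑ a ∈ range M, ∑ b ∈ Ico M (K - 1),
          mix D a b * (y i j * (if a < i ∧ b < j then 1 else 0))) := by
      unfold SqCost
      refine sum_congr rfl fun i hi => sum_congr rfl fun j hj => ?_
      simp at hi hj
      have e2 : (y i j + if i = j then min (μ i) (ν i) else 0) * D i j = y i j * D i j := by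
        split_ifs with h
        · rw [h, hdiag]; ring
        · ring
      rw [e2]
      by_cases h : i ≤ M ∧ M ≤ j
      · conv_lhs => rw [decomp h01 hM h.1 h.2 hj]
        rw [mul_add, mul_sum]
        congr 1
        refine sum_congr rfl fun a _ => ?_
        rw [mul_sum]
        exact sum_congr rfl fun b _ => by ring
      · have : y i j = 0 := by
          rcases Nat.lt_or_ge M i with h1 | h1
          · exact sq_row_zero hy hi hj (hαM' i h1 hi)
          · exact sq_col_zero hy hi hj (hβM j (by omega))
        simp [this]
    rw [e1]
    simp only [sum_add_distrib, G]
    congr 1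
    · rw [← sum_subset (s₁ := range M) (s₂ := range K)]
      · refine sum_congr rfl fun i hi => ?_
        simp at hi
        rw [← sum_mul, hy.2.1 i (by omega), hαM i hi, mul_comm]
      · intro t ht; simp at *; omega
      · intro i hi hi'
        simp at hi hi'
        rw [← sum_mul, hy.2.1 i hi]
        rcases hi'.eq_or_lt with h | h
        · rw [h, hdiag, mul_zero]
        · rw [hαM' i h hi, zero_mul]
    · have e3 : ∀ i ∈ range K, ∑ j ∈ range K, ∑ a ∈ range M, ∑ b ∈ Ico M (K - 1),
          mix D a b * (y i j * (if a < i ∧ b < j then 1 else 0))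
          = ∑ a ∈ range M, ∑ b ∈ Ico M (K - 1), ∑ j ∈ range K,
          mix D a b * (y i j * (if a < i ∧ b < j then 1 else 0)) := by
        intro i _
        rw [sum_comm]
        exact sum_congr rfl fun a _ => sum_comm
      rw [sum_congr rfl e3, sum_comm]
      refine sum_congr rfl fun a ha => ?_
      rw [sum_comm]
      refine sum_congr rfl fun b hb => ?_
      simp at ha hb
      simp only [← mul_sum]
      congr 1
      have e4 : ∑ i ∈ range K, ∑ j ∈ range K, y i j * (if a < i ∧ b < j then 1 else 0)
          = ∑ i ∈ Ico (a + 1) K, ∑ j ∈ Ico (b + 1) K, y i j := by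
        symm
        rw [← sum_subset (s₁ := Ico (a + 1) K) (s₂ := range K)]
        · refine sum_congr rfl fun i hi => ?_
          simp at hi
          rw [← sum_subset (s₁ := Ico (b + 1) K) (s₂ := range K)]
          · refine sum_congr rfl fun j hj => ?_
            simp at hj
            rw [if_pos (by omega), mul_one]
          · intro t ht; simp at *; omega
          · intro j hj hj'
            simp at hj hj'
            rw [if_neg (by omega), mul_zero]
        · intro t ht; simp at *; omega
        · intro i hi hi'
          simp at hi hi'
          refine sum_eq_zero fun j _ => ?_
          rw [if_neg (by omega), mul_zero]
      rw [e4, hyr (a + 1) (b + 1) (by omega) (by omega)]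
      congr 1
      have e5 : ∑ j ∈ Ico (b + 1) K, β j = - ∑ j ∈ Ico (b + 1) K, f j := by
        rw [← sum_neg_distrib]
        refine sum_congr rfl fun j hj => ?_
        simp at hj
        exact hβM' j (by omega) (by omega)
      have e6 : ∑ i ∈ range (a + 1), α i = ∑ i ∈ range (a + 1), f i := by
        refine sum_congr rfl fun j hj => ?_
        simp at hj
        exact hαM j (by omega)
      have e7 := sum_range_add_sum_Ico f (show a + 1 ≤ b + 1 by omega)
      have e8 := sum_range_add_sum_Ico f (show b + 1 ≤ K by omega)
      rw [e5, e6]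
      linarith

lemma H_anti {π : ℕ → ℕ → ℝ} (hH : CondH π) {m n i : ℕ} (hmn : m ≤ n) (hi : i ≤ m) :
    π n i ≤ π m i := by
  induction n, hmn using Nat.le_induction with
  | base => exact le_rfl
  | succ n hn ih => exact ((hH n).2 i (by omega)).trans ih

lemma D_one {π D : ℕ → ℕ → ℝ} (hπ : ∀ n, IsProbOn (π n) n) (hD : IsRecursiveOT π D) (n : ℕ) :
    D 1 (n + 1) = 1 - π n 0 := by
  obtain ⟨z, hz, he⟩ := ot_attain hπ hD (m := 0) (n := n) (K := n + 1) (by omega) (by omega)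
  have h0 : ∀ j, j < n + 1 → z 0 j = π n j := by
    intro j hj
    rw [← hz.2.2 j hj, sum_range_succ', sum_eq_zero, zero_add]
    intro i hi
    simp at hi
    exact sq_row_zero hz (by omega) hj ((hπ 0).2.1 _ (by omega))
  have hs : SqCost D (n + 1) z = ∑ j ∈ range (n + 1), z 0 j * D 0 j := by
    unfold SqCost
    rw [sum_range_succ', sum_eq_zero, zero_add]
    intro i hi
    simp at hi
    refine sum_eq_zero fun j hj => ?_
    simp at hj
    rw [sq_row_zero hz (by omega) (by omega) ((hπ 0).2.1 _ (by omega)), zero_mul]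
  have hp := (hπ n).2.2
  rw [sum_range_succ'] at hp hs
  rw [zero_add] at he
  rw [he, hs, hD.1, ← hp]
  have : ∑ k ∈ range n, z 0 (k + 1) * D 0 (k + 1) = ∑ k ∈ range n, π n (k + 1) := by
    refine sum_congr rfl fun k hk => ?_
    simp at hk
    rw [hD.2.1, mul_one, h0 _ (by omega)]
  rw [this]; ring

lemma max_four (x E F : ℝ) (hE : 0 ≤ E) (hF : 0 ≤ F) :
    max 0 (x + E) + max 0 (x + F) ≤ max 0 x + max 0 (x + E + F) := by
  rcases le_total 0 x with c1 | c1 <;> rcases le_total 0 (x + E) with c2 | c2 <;>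
  rcases le_total 0 (x + F) with c3 | c3 <;> rcases le_total 0 (x + E + F) with c4 | c4 <;>
  simp only [c1, c2, c3, c4, max_eq_left, max_eq_right] <;> linarith

lemma cell {π D : ℕ → ℕ → ℝ} (hπ : ∀ n, IsProbOn (π n) n) (hH : CondH π)
    (hD : IsRecursiveOT π D) : ∀ b a, a < b → 0 ≤ mix D a b := by
  intro b
  induction b using Nat.strong_induction_on with
  | _ b ih =>
  intro a hab
  obtain ⟨n, rfl⟩ : ∃ n, b = n + 1 := ⟨b - 1, by omega⟩
  rcases a with _ | m
  · simp only [mix]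
    rw [hD.2.1, hD.2.1, zero_add, D_one hπ hD, D_one hπ hD]
    linarith [(hH n).2 0 (by omega)]
  have hmn : m < n := by omega
  have hdiag := D_diag hπ hD
  have htri : ∀ i j k, D i k ≤ D i j + D j k := fun i j k =>
    D_tri hπ hD (i + j + k) i j k (by omega) (by omega) (by omega)
  have hw : ∀ a b, a < m + 1 → m + 1 ≤ b → b < n + 2 - 1 → 0 ≤ mix D a b :=
    fun a b ha hb hb' => ih b (by omega) a (by omega)
  have hpos : ∀ m' n', m ≤ m' → m' ≤ n' → ∀ t, t < m + 1 → π n' t ≤ π m' t :=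
    fun m' n' h1 h2 t ht => H_anti hH h2 (by omega)
  have hneg : ∀ m' n', m' ≤ m + 1 → ∀ t, m + 1 < t → t < n + 2 → π m' t ≤ π n' t := by
    intro m' n' h1 t ht _
    rw [(hπ m').2.1 t (by omega)]
    exact (hπ n').1 t
  obtain ⟨z00, p00, c00⟩ := ot_attain hπ hD (m := m) (n := n) (K := n + 2) (by omega) (by omega)
  obtain ⟨z11, p11, c11⟩ := ot_attain hπ hD (m := m + 1) (n := n + 1) (K := n + 2)
    (by omega) (by omega)
  have l00 := lower hD.2.1 hdiag htri (by omega) (by omega) hw p00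
    (hpos _ _ (by omega) (by omega)) (hneg _ _ (by omega))
  have l11 := lower hD.2.1 hdiag htri (by omega) (by omega) hw p11
    (hpos _ _ (by omega) (by omega)) (hneg _ _ (by omega))
  have hsum : ∀ m' n', m' < n + 2 → n' < n + 2 →
      ∑ i ∈ range (n + 2), π m' i = ∑ i ∈ range (n + 2), π n' i := by
    intro m' n' h1 h2
    rw [prob_sum (hπ m') h1, prob_sum (hπ n') h2]
  obtain ⟨z01, p01, c01⟩ := upper (M := m + 1) hD.2.1 hdiag (by omega) (by omega)
    (hπ m).1 (hπ (n + 1)).1 (hsum m (n + 1) (by omega) (by omega))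
    (hpos _ _ (by omega) (by omega)) (hneg _ _ (by omega))
  obtain ⟨z10, p10, c10⟩ := upper (M := m + 1) hD.2.1 hdiag (by omega) (by omega)
    (hπ (m + 1)).1 (hπ n).1 (hsum (m + 1) n (by omega) (by omega))
    (hpos _ _ (by omega) (by omega)) (hneg _ _ (by omega))
  have u01 := ot_le hπ hD (by omega) (by omega) p01
  have u10 := ot_le hπ hD (by omega) (by omega) p10
  rw [c01] at u01
  rw [c10] at u10
  rw [← c00] at l00
  rw [← c11] at l11
  have key : G D (m + 1) (n + 2) (fun t => π m t - π (n + 1) t) +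
      G D (m + 1) (n + 2) (fun t => π (m + 1) t - π n t) ≤
      G D (m + 1) (n + 2) (fun t => π m t - π n t) +
      G D (m + 1) (n + 2) (fun t => π (m + 1) t - π (n + 1) t) := by
    unfold G
    have e1 : ∑ i ∈ range (m + 1), D i (m + 1) * (π m i - π (n + 1) i) +
        ∑ i ∈ range (m + 1), D i (m + 1) * (π (m + 1) i - π n i) =
        ∑ i ∈ range (m + 1), D i (m + 1) * (π m i - π n i) +
        ∑ i ∈ range (m + 1), D i (m + 1) * (π (m + 1) i - π (n + 1) i) := by
      rw [← sum_add_distrib, ← sum_add_distrib]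
      exact sum_congr rfl fun i _ => by ring
    have e2 : (∑ a ∈ range (m + 1), ∑ b ∈ Ico (m + 1) (n + 2 - 1),
          mix D a b * max 0 (∑ t ∈ Ico (a + 1) (b + 1), (π m t - π (n + 1) t))) +
        (∑ a ∈ range (m + 1), ∑ b ∈ Ico (m + 1) (n + 2 - 1),
          mix D a b * max 0 (∑ t ∈ Ico (a + 1) (b + 1), (π (m + 1) t - π n t))) ≤
        (∑ a ∈ range (m + 1), ∑ b ∈ Ico (m + 1) (n + 2 - 1),
          mix D a b * max 0 (∑ t ∈ Ico (a + 1) (b + 1), (π m t - π n t))) +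
        (∑ a ∈ range (m + 1), ∑ b ∈ Ico (m + 1) (n + 2 - 1),
          mix D a b * max 0 (∑ t ∈ Ico (a + 1) (b + 1), (π (m + 1) t - π (n + 1) t))) := by
      rw [← sum_add_distrib, ← sum_add_distrib]
      refine sum_le_sum fun a ha => ?_
      rw [← sum_add_distrib, ← sum_add_distrib]
      refine sum_le_sum fun b hb => ?_
      simp at ha hb
      rw [← mul_add, ← mul_add]
      refine mul_le_mul_of_nonneg_left ?_ (hw a b (by omega) (by omega) (by omega))
      simp only [sum_sub_distrib]
      have hE : ∑ t ∈ Ico (a + 1) (b + 1), π (n + 1) t ≤ ∑ t ∈ Ico (a + 1) (b + 1), π n t := by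
        refine sum_le_sum fun t ht => ?_
        simp at ht
        exact (hH n).2 t (by omega)
      have hF : ∑ t ∈ Ico (a + 1) (b + 1), π m t ≤ ∑ t ∈ Ico (a + 1) (b + 1), π (m + 1) t := by
        have s1 := prob_sum (hπ m) (show m < b + 1 by omega)
        have s2 := prob_sum (hπ (m + 1)) (show m + 1 < b + 1 by omega)
        have s3 := sum_range_add_sum_Ico (π m) (show a + 1 ≤ b + 1 by omega)
        have s4 := sum_range_add_sum_Ico (π (m + 1)) (show a + 1 ≤ b + 1 by omega)
        have s5 : ∑ t ∈ range (a + 1), π (m + 1) t ≤ ∑ t ∈ range (a + 1), π m t := by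
          refine sum_le_sum fun t ht => ?_
          simp at ht
          exact (hH m).2 t (by omega)
        linarith
      set x00 := ∑ t ∈ Ico (a + 1) (b + 1), π m t
      set x10 := ∑ t ∈ Ico (a + 1) (b + 1), π (m + 1) t
      set y0 := ∑ t ∈ Ico (a + 1) (b + 1), π n t
      set y1 := ∑ t ∈ Ico (a + 1) (b + 1), π (n + 1) t
      have := max_four (x00 - y0) (y0 - y1) (x10 - x00) (by linarith) (by linarith)
      rw [show x00 - y0 + (y0 - y1) = x00 - y1 by ring,
        show x00 - y0 + (x10 - x00) = x10 - y0 by ring,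
        show x00 - y1 + (x10 - x00) = x10 - y1 by ring] at this
      exact this
    linarith
  simp only [mix]
  linarith

/-- under condition (H), the recursive optimal transport metric satisfies
the convex quadrangle inequality `d_{i,l} + d_{j,k} ≤ d_{i,k} + d_{j,l}` for all
`−1 ≤ i ≤ j ≤ k ≤ l` (indices shifted by one so that `0` plays the role of `−1`). -/
theorem recursiveOT_quadrangle (π D : ℕ → ℕ → ℝ)
    (hπ : ∀ n, IsProbOn (π n) n)
    (hH : CondH π)
    (hD : IsRecursiveOT π D) :
    ∀ i j k l : ℕ, i ≤ j → j ≤ k → k ≤ l →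
      D i l + D j k ≤ D i k + D j l := by
  intro i j k l hij hjk hkl
  have h := rect D hij hkl
  have h0 : 0 ≤ ∑ a ∈ Finset.Ico i j, ∑ b ∈ Finset.Ico k l, mix D a b := by
    refine Finset.sum_nonneg fun a ha => Finset.sum_nonneg fun b hb => ?_
    simp at ha hb
    exact cell hπ hH hD b a (by omega)
  linarith
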